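/- Consider the Private Populous Estimator (PPE): given a dataset D = (X₁,...,X_m), a (possibly randomized) algorithm 𝒜 : 𝒳* → 𝒴, and parameters r, ε, δ > 0, z ≥ 1, t ∈ ℕ, PPE sets s = ⌊m/t⌋, computes Y_i = 𝒜(X_{(i−1)s+1},...,X_{is}) for i ∈ [t], computes q_i = (1/t)·|{j ∈ [t] : dist(Y_i,Y_j) ≤ r/(2z)}| and Q = (1/t)·Σ_{i∈[t]} q_i, samples Z from the truncated Laplace distribution TLap(2/t, ε, δ), sets Q̃ = Q + Z, outputs ⊥ if Q̃ < 0.8 + (2/(tε))·ln(1 + (e^ε − 1)/(2δ)), and otherwise sets j = min{i : q_i > 0.6} and returns ℬ(Y_j). If (𝒴, dist) is a semimetric space satisfying the z-approximate r-restricted triangle inequality, ℬ is an (r, ε, δ)-masking mechanism for (𝒴, dist), and t > 5, then PPE is (2ε, 4e^ε δ)-differentially private; that is, for any two datasets D, D' differing in one element and any measurable set S of outputs, Pr[PPE(D) ∈ S] ≤ e^{2ε}·Pr[PPE(D') ∈ S] + 4e^ε δ. -/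

import Mathlib

open MeasureTheory
open scoped Classical

/-- A measurable-space structure on `Option α`, via the identification with `α ⊕ Unit`. -/
noncomputable instance optionMeasurableSpace {α : Type*} [MeasurableSpace α] :
    MeasurableSpace (Option α) :=
  MeasurableSpace.comap (fun o => Option.elim o (Sum.inr ()) Sum.inl) inferInstance

/-- The truncated Laplace distribution `TLap(Δ, ε, δ)`: density proportional to
`exp (-ε |x| / Δ)` on `[-B, B]` where `B = (Δ/ε) * ln (1 + (e^ε - 1)/(2δ))`, zero outside. -/
noncomputable def TLap (Δ ε δ : ℝ) : Measure ℝ :=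
  let B := (Δ / ε) * Real.log (1 + (Real.exp ε - 1) / (2 * δ))
  let μ := MeasureTheory.volume.withDensity
    (Set.indicator (Set.Icc (-B) B) fun x => ENNReal.ofReal (Real.exp (-(ε * |x|) / Δ)))
  (μ Set.univ)⁻¹ • μ

/-- The Private Populous Estimator (PPE), as a randomized mechanism taking a dataset
`D : List 𝒳` to a distribution over `Option 𝒴` (`none` is the failure output `⊥`):
it splits `D` into `t` chunks of size `s = ⌊m/t⌋`, runs `𝒜` on each chunk to get
`Y₁, …, Y_t`, computes the closeness scores `q_i` and their average `Q`, adds truncated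
Laplace noise `Z ~ TLap(2/t, ε, δ)`, fails if `Q + Z < 0.8 + (2/(tε)) ln(1 + (e^ε-1)/(2δ))`,
and otherwise returns `ℬ(Y_j)` for the least index `j` with `q_j > 0.6`. -/
noncomputable def PPE {𝒳 𝒴 : Type*} [MeasurableSpace 𝒴] (t : ℕ)
    (𝒜 : List 𝒳 → Measure 𝒴) (ℬ : 𝒴 → Measure 𝒴)
    (dist : 𝒴 → 𝒴 → ℝ) (r ε δ z : ℝ) (D : List 𝒳) : Measure (Option 𝒴) :=
  let s := D.length / t
  (Measure.pi fun i : Fin t => 𝒜 ((D.drop (i.1 * s)).take s)).bind fun Y =>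
    (TLap (2 / t) ε δ).bind fun Zv =>
      let q : Fin t → ℝ := fun i =>
        (1 / (t : ℝ)) * ((Finset.univ.filter fun j => dist (Y i) (Y j) ≤ r / (2 * z)).card : ℝ)
      let Q := (1 / (t : ℝ)) * ∑ i, q i
      if Q + Zv < 0.8 + (2 / (t * ε)) * Real.log (1 + (Real.exp ε - 1) / (2 * δ)) then
        Measure.dirac none
      else if h : (Finset.univ.filter fun i => (0.6 : ℝ) < q i).Nonempty then
        (ℬ (Y ((Finset.univ.filter fun i => (0.6 : ℝ) < q i).min' h))).map Option.some
      else Measure.dirac none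

/-- Two datasets are neighboring if they have the same length and differ in (at most)
one element. -/
def Neighboring {𝒳 : Type*} (D D' : List 𝒳) : Prop :=
  D.length = D'.length ∧ ∃ i : ℕ, ∀ j : ℕ, j ≠ i → D[j]? = D'[j]?

/-- Two distributions are `(ε, δ)`-indistinguishable. -/
def Indist {𝒴 : Type*} [MeasurableSpace 𝒴] (ε δ : ℝ) (μ ν : Measure 𝒴) : Prop :=
  ∀ S : Set 𝒴, MeasurableSet S →
    μ S ≤ ENNReal.ofReal (Real.exp ε) * ν S + ENNReal.ofReal δ ∧
    ν S ≤ ENNReal.ofReal (Real.exp ε) * μ S + ENNReal.ofReal δ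


lemma lint_exp (a c d : ℝ) (ha : a ≠ 0) (hcd : c ≤ d) :
    ∫⁻ x in Set.Icc c d, ENNReal.ofReal (Real.exp (a * x)) =
      ENNReal.ofReal ((Real.exp (a * d) - Real.exp (a * c)) / a) := by
  have hc : Continuous fun x : ℝ => Real.exp (a * x) := by fun_prop
  rw [← ofReal_integral_eq_lintegral_ofReal (hc.integrableOn_Icc)
    (Filter.Eventually.of_forall fun x => (Real.exp_pos _).le),
    integral_Icc_eq_integral_Ioc, ← intervalIntegral.integral_of_le hcd,
    intervalIntegral.integral_eq_sub_of_hasDerivAt (f := fun x => Real.exp (a * x) / a)]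
  · congr 1; ring
  · intro x _
    have h := (((hasDerivAt_id x).const_mul a).exp).div_const a
    have e : Real.exp (a * id x) * (a * 1) / a = Real.exp (a * x) := by
      simp only [id]; field_simp
    rw [e] at h
    exact h
  · exact hc.intervalIntegrable _ _

/-- unnormalised density -/
noncomputable def hden (a B : ℝ) : ℝ → ENNReal :=
  Set.indicator (Set.Icc (-B) B) fun x => ENNReal.ofReal (Real.exp (-(a * |x|)))

lemma hden_meas (a B : ℝ) : Measurable (hden a B) := by
  unfold hden
  exact Measurable.indicator (by fun_prop) measurableSet_Icc

lemma hden_total (a B : ℝ) (ha : 0 < a) (hB : 0 < B) :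
    ∫⁻ x, hden a B x = ENNReal.ofReal (2 * (1 - Real.exp (-(a * B))) / a) := by
  unfold hden
  rw [lintegral_indicator measurableSet_Icc]
  have hle : Real.exp (-(a * B)) ≤ 1 := Real.exp_le_one_iff.mpr (by nlinarith [mul_pos ha hB])
  have hU : Set.Icc (-B) B = Set.Icc (-B) 0 ∪ Set.Ioc 0 B := by
    rw [Set.Icc_union_Ioc_eq_Icc] <;> linarith
  rw [hU, lintegral_union measurableSet_Ioc]
  · rw [setLIntegral_congr_fun (g := fun x => ENNReal.ofReal (Real.exp (a * x)))
        measurableSet_Icc, lint_exp a _ _ ha.ne' (by linarith)]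
    · rw [setLIntegral_congr_fun (g := fun x => ENNReal.ofReal (Real.exp (-a * x)))
        measurableSet_Ioc, setLIntegral_congr (Ioc_ae_eq_Icc),
        lint_exp (-a) _ _ (by linarith) (by linarith), ← ENNReal.ofReal_add]
      · congr 1; simp; field_simp; ring
      · apply div_nonneg _ ha.le
        simp; exact (mul_pos ha hB).le
      · rw [div_neg, ← neg_div]
        apply div_nonneg _ ha.le
        simp; exact (mul_pos ha hB).le
      · intro x hx
        simp [abs_of_pos hx.1]
    · intro x hx
      simp [abs_of_nonpos hx.2]
  · rw [Set.disjoint_left]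
    intro x hx hx'
    exact absurd hx.2 (not_le.mpr hx'.1)

lemma hden_edge (a B Δ s : ℝ) (ha : 0 < a) (hΔ : 0 < Δ) (hs : |s| ≤ Δ) :
    ∫⁻ x, (Set.indicator {x | x - s ∉ Set.Icc (-B) B} (hden a B)) x ≤
      ENNReal.ofReal (Real.exp (-(a * B)) * (Real.exp (a * Δ) - 1) / a) := by
  obtain ⟨h1, h2⟩ := abs_le.mp hs
  rcases le_total 0 s with h0 | h0
  · have := lint_exp a (-B) (-B + Δ) ha.ne' (by linarith)
    have e : (Real.exp (a * (-B + Δ)) - Real.exp (a * -B)) / a =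
      Real.exp (-(a * B)) * (Real.exp (a * Δ) - 1) / a := by
      rw [mul_add, Real.exp_add]; simp; ring
    rw [← e, ← this, ← lintegral_indicator measurableSet_Icc]
    apply lintegral_mono
    intro x
    by_cases hx : x - s ∈ Set.Icc (-B) B
    · rw [Set.indicator_of_notMem (by simpa only [Set.mem_setOf_eq, not_not] using hx)]
      exact zero_le
    · rw [Set.indicator_of_mem (by exact hx)]
      unfold hden
      by_cases hI : x ∈ Set.Icc (-B) B
      · have : x ∈ Set.Icc (-B) (-B + Δ) := by
          refine ⟨hI.1, ?_⟩
          by_contra hh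
          exact hx ⟨by linarith, by linarith [hI.2]⟩
        rw [Set.indicator_of_mem hI, Set.indicator_of_mem this]
        apply ENNReal.ofReal_le_ofReal
        apply Real.exp_le_exp.mpr
        nlinarith [neg_abs_le x]
      · rw [Set.indicator_of_notMem hI]; exact zero_le
  · have := lint_exp (-a) (B - Δ) B (by linarith) (by linarith)
    have e : (Real.exp (-a * B) - Real.exp (-a * (B - Δ))) / -a =
      Real.exp (-(a * B)) * (Real.exp (a * Δ) - 1) / a := by
      rw [show -a * (B - Δ) = -(a * B) + a * Δ by ring, Real.exp_add]; simp; field_simp; ring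
    rw [← e, ← this, ← lintegral_indicator measurableSet_Icc]
    apply lintegral_mono
    intro x
    by_cases hx : x - s ∈ Set.Icc (-B) B
    · rw [Set.indicator_of_notMem (by simpa only [Set.mem_setOf_eq, not_not] using hx)]
      exact zero_le
    · rw [Set.indicator_of_mem (by exact hx)]
      unfold hden
      by_cases hI : x ∈ Set.Icc (-B) B
      · have : x ∈ Set.Icc (B - Δ) B := by
          refine ⟨?_, hI.2⟩
          by_contra hh
          exact hx ⟨by linarith [hI.1], by linarith⟩
        rw [Set.indicator_of_mem hI, Set.indicator_of_mem this]
        apply ENNReal.ofReal_le_ofReal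
        apply Real.exp_le_exp.mpr
        nlinarith [le_abs_self x]
      · rw [Set.indicator_of_notMem hI]; exact zero_le

lemma hden_shift (a B Δ s : ℝ) (ha : 0 < a) (hs : |s| ≤ Δ) (x : ℝ) :
    hden a B x ≤ ENNReal.ofReal (Real.exp (a * Δ)) * hden a B (x - s) +
      (Set.indicator {x | x - s ∉ Set.Icc (-B) B} (hden a B)) x := by
  by_cases hx : x - s ∈ Set.Icc (-B) B
  · refine le_trans ?_ le_self_add
    unfold hden
    by_cases hI : x ∈ Set.Icc (-B) B
    · rw [Set.indicator_of_mem hI, Set.indicator_of_mem hx,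
        ← ENNReal.ofReal_mul (Real.exp_pos _).le, ← Real.exp_add]
      apply ENNReal.ofReal_le_ofReal
      apply Real.exp_le_exp.mpr
      have := abs_sub x s
      nlinarith
    · rw [Set.indicator_of_notMem hI]; exact zero_le
  · rw [Set.indicator_of_mem (by exact hx)]
    exact le_add_self

noncomputable def Bd (Δ ε δ : ℝ) : ℝ := (Δ / ε) * Real.log (1 + (Real.exp ε - 1) / (2 * δ))

lemma Bd_pos {Δ ε δ : ℝ} (hΔ : 0 < Δ) (hε : 0 < ε) (hδ : 0 < δ) : 0 < Bd Δ ε δ := by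
  have : 0 < Real.exp ε - 1 := by linarith [Real.add_one_lt_exp hε.ne']
  exact mul_pos (by positivity) (Real.log_pos (by linarith [show 0 < (Real.exp ε - 1) / (2 * δ) by positivity]))

lemma TLap_apply {Δ ε δ : ℝ} (A : Set ℝ) (hA : MeasurableSet A) :
    TLap Δ ε δ A = (∫⁻ x, hden (ε / Δ) (Bd Δ ε δ) x)⁻¹ * ∫⁻ x in A, hden (ε / Δ) (Bd Δ ε δ) x := by
  have h : (Set.indicator (Set.Icc (-(Bd Δ ε δ)) (Bd Δ ε δ)) fun x => ENNReal.ofReal (Real.exp (-(ε * |x|) / Δ)))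
    = hden (ε / Δ) (Bd Δ ε δ) := by
    unfold hden; congr 1; ext x; congr 2; ring
  unfold TLap
  simp only [← Bd.eq_def]
  rw [h, Measure.smul_apply, withDensity_apply _ hA, withDensity_apply _ MeasurableSet.univ]
  simp

lemma total_props {Δ ε δ : ℝ} (hΔ : 0 < Δ) (hε : 0 < ε) (hδ : 0 < δ) :
    ∫⁻ x, hden (ε / Δ) (Bd Δ ε δ) x ≠ 0 ∧ ∫⁻ x, hden (ε / Δ) (Bd Δ ε δ) x ≠ ⊤ := by
  have ha : 0 < ε / Δ := by positivity
  rw [hden_total _ _ ha (Bd_pos hΔ hε hδ)]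
  refine ⟨?_, ENNReal.ofReal_ne_top⟩
  have : Real.exp (-(ε / Δ * Bd Δ ε δ)) < 1 := by
    rw [Real.exp_lt_one_iff]
    linarith [mul_pos ha (Bd_pos hΔ hε hδ)]
  simp only [ne_eq, ENNReal.ofReal_eq_zero, not_le]
  apply div_pos _ ha
  linarith

lemma TLap_prob {Δ ε δ : ℝ} (hΔ : 0 < Δ) (hε : 0 < ε) (hδ : 0 < δ) :
    IsProbabilityMeasure (TLap Δ ε δ) := by
  obtain ⟨h1, h2⟩ := total_props hΔ hε hδ
  constructor
  rw [TLap_apply _ MeasurableSet.univ, setLIntegral_univ, ENNReal.inv_mul_cancel h1 h2]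

lemma TLap_shift {Δ ε δ s : ℝ} (hΔ : 0 < Δ) (hε : 0 < ε) (hδ : 0 < δ) (hs : |s| ≤ Δ)
    (A : Set ℝ) (hA : MeasurableSet A) :
    TLap Δ ε δ A ≤ ENNReal.ofReal (Real.exp ε) * TLap Δ ε δ ((fun x => x + s) ⁻¹' A) +
      ENNReal.ofReal δ := by
  obtain ⟨h1, h2⟩ := total_props hΔ hε hδ
  have ha : 0 < ε / Δ := by positivity
  have hm := hden_meas (ε / Δ) (Bd Δ ε δ)
  have haΔ : ε / Δ * Δ = ε := by field_simp
  have haB : ε / Δ * Bd Δ ε δ = Real.log (1 + (Real.exp ε - 1) / (2 * δ)) := by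
    unfold Bd; field_simp
  have hE : 0 < Real.exp ε - 1 := by linarith [Real.add_one_lt_exp hε.ne']
  have hedge := hden_edge (ε / Δ) (Bd Δ ε δ) Δ s ha hΔ hs
  have hδN : ENNReal.ofReal (Real.exp (-(ε / Δ * Bd Δ ε δ)) * (Real.exp (ε / Δ * Δ) - 1) / (ε / Δ))
      = ENNReal.ofReal δ * ∫⁻ x, hden (ε / Δ) (Bd Δ ε δ) x := by
    rw [hden_total _ _ ha (Bd_pos hΔ hε hδ), ← ENNReal.ofReal_mul hδ.le, haΔ, haB, Real.exp_neg,
      Real.exp_log (by positivity)]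
    congr 1
    field_simp
    ring
  rw [hδN] at hedge
  have key : ∫⁻ x in A, hden (ε / Δ) (Bd Δ ε δ) x ≤
      ENNReal.ofReal (Real.exp ε) * (∫⁻ x in (fun x => x + s) ⁻¹' A, hden (ε / Δ) (Bd Δ ε δ) x) +
      ENNReal.ofReal δ * ∫⁻ x, hden (ε / Δ) (Bd Δ ε δ) x := by
    have htr : ∫⁻ x in (fun x => x + s) ⁻¹' A, hden (ε / Δ) (Bd Δ ε δ) x =
        ∫⁻ x in A, hden (ε / Δ) (Bd Δ ε δ) (x - s) := by
      have := (measurePreserving_add_right (volume : Measure ℝ) s).setLIntegral_comp_preimage hA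
        (f := fun x => hden (ε / Δ) (Bd Δ ε δ) (x - s)) (by fun_prop)
      simpa using this
    rw [htr]
    calc _ ≤ ∫⁻ x in A, (ENNReal.ofReal (Real.exp ε) * hden (ε / Δ) (Bd Δ ε δ) (x - s) +
          (Set.indicator {x | x - s ∉ Set.Icc (-Bd Δ ε δ) (Bd Δ ε δ)} (hden (ε / Δ) (Bd Δ ε δ))) x) := by
          apply lintegral_mono
          intro x
          have := hden_shift (ε / Δ) (Bd Δ ε δ) Δ s ha hs x
          rwa [haΔ] at this
      _ = ENNReal.ofReal (Real.exp ε) * (∫⁻ x in A, hden (ε / Δ) (Bd Δ ε δ) (x - s)) +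
          ∫⁻ x in A, (Set.indicator {x | x - s ∉ Set.Icc (-Bd Δ ε δ) (Bd Δ ε δ)} (hden (ε / Δ) (Bd Δ ε δ))) x := by
          rw [lintegral_add_left (by fun_prop), lintegral_const_mul _ (by fun_prop)]
      _ ≤ _ := by
          gcongr
          exact (setLIntegral_le_lintegral _ _).trans hedge
  have hA' : MeasurableSet ((fun x => x + s) ⁻¹' A) := (measurable_id.add_const s) hA
  rw [TLap_apply A hA, TLap_apply _ hA']
  refine (mul_le_mul_right key _).trans (le_of_eq ?_)
  rw [mul_add, mul_left_comm, mul_left_comm _ (ENNReal.ofReal δ), ENNReal.inv_mul_cancel h1 h2,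
    mul_one]

lemma TLap_tail {Δ ε δ c : ℝ} (hc : Bd Δ ε δ < c) : TLap Δ ε δ (Set.Ici c) = 0 := by
  rw [TLap_apply _ measurableSet_Ici, setLIntegral_congr_fun (g := fun _ => 0) measurableSet_Ici]
  · simp
  · intro x hx
    unfold hden
    rw [Set.indicator_of_notMem]
    intro h
    have h1 := h.2
    have : c ≤ x := hx
    linarith

lemma pi_couple {t : ℕ} {𝒴 : Type*} [MeasurableSpace 𝒴] (ν ν' : Fin t → Measure 𝒴)
    [∀ i, IsProbabilityMeasure (ν i)] [∀ i, IsProbabilityMeasure (ν' i)] (k : Fin t)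
    (h : ∀ i, i ≠ k → ν i = ν' i) :
    ((Measure.pi ν).prod (ν' k)).map (fun p => Function.update p.1 k p.2) = Measure.pi ν' := by
  symm
  apply Measure.pi_eq
  intro s hs
  rw [Measure.map_apply measurable_update' (MeasurableSet.univ_pi hs)]
  have : (fun p : (Fin t → 𝒴) × 𝒴 => Function.update p.1 k p.2) ⁻¹' (Set.univ.pi s) =
      (Set.univ.pi (Function.update s k Set.univ)) ×ˢ s k := by
    ext p
    simp only [Set.mem_preimage, Set.mem_pi, Set.mem_univ, true_imp_iff, Set.mem_prod]
    constructor
    · intro hp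
      refine ⟨fun i => ?_, by simpa using hp k⟩
      by_cases hi : i = k
      · subst hi; simp
      · simpa [hi] using hp i
    · rintro ⟨h1, h2⟩ i
      by_cases hi : i = k
      · subst hi; simpa using h2
      · simpa [hi] using h1 i
  rw [this, Measure.prod_prod, Measure.pi_pi, ← Finset.prod_erase_mul _ _ (Finset.mem_univ k),
    ← Finset.prod_erase_mul Finset.univ (fun i => ν' i (s i)) (Finset.mem_univ k)]
  simp only [Function.update_self, measure_univ, mul_one]
  congr 1
  apply Finset.prod_congr rfl
  intro i hi
  have hi := Finset.ne_of_mem_erase hi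
  simp [hi, h i hi]

lemma couple_le {t : ℕ} {𝒴 : Type*} [MeasurableSpace 𝒴] (ν ν' : Fin t → Measure 𝒴)
    [∀ i, IsProbabilityMeasure (ν i)] [∀ i, IsProbabilityMeasure (ν' i)] (k : Fin t)
    (h : ∀ i, i ≠ k → ν i = ν' i) (f : (Fin t → 𝒴) → ENNReal) (hf : Measurable f) (C c : ENNReal)
    (hfle : ∀ Y y, f Y ≤ C * f (Function.update Y k y) + c) :
    ∫⁻ Y, f Y ∂(Measure.pi ν) ≤ C * ∫⁻ Y, f Y ∂(Measure.pi ν') + c := by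
  rw [← pi_couple ν ν' k h, lintegral_map hf measurable_update']
  have hm : Measurable fun p : (Fin t → 𝒴) × 𝒴 => f (Function.update p.1 k p.2) :=
    hf.comp measurable_update'
  calc ∫⁻ Y, f Y ∂(Measure.pi ν) = ∫⁻ p, f p.1 ∂((Measure.pi ν).prod (ν' k)) := by
        rw [lintegral_prod _ (by fun_prop)]; simp
    _ ≤ ∫⁻ p, (C * f (Function.update p.1 k p.2) + c) ∂((Measure.pi ν).prod (ν' k)) :=
        lintegral_mono fun p => hfle _ _
    _ = _ := by
        rw [lintegral_add_left (by fun_prop), lintegral_const_mul _ hm]; simp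

lemma chunk_eq {𝒳 : Type*} (D D' : List 𝒳) (hnb : Neighboring D D') (t : ℕ) (ht : 0 < t) (s : ℕ) :
    ∃ k : Fin t, ∀ n : Fin t, n ≠ k →
      (D.drop (n.1 * s)).take s = (D'.drop (n.1 * s)).take s := by
  obtain ⟨-, i, hi⟩ := hnb
  have key : ∀ n : ℕ, n ≠ i / s → (D.drop (n * s)).take s = (D'.drop (n * s)).take s := by
    intro n hn
    apply List.ext_getElem?
    intro j
    rw [List.getElem?_take, List.getElem?_take]
    split_ifs with hj
    · rw [List.getElem?_drop, List.getElem?_drop]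
      apply hi
      intro h
      apply hn
      rw [← h, Nat.add_comm, Nat.add_mul_div_right _ _ (by omega), Nat.div_eq_of_lt hj, zero_add]
    · rfl
  by_cases hk : i / s < t
  · exact ⟨⟨i / s, hk⟩, fun n hn => key n fun h => hn (Fin.ext h)⟩
  · exact ⟨⟨0, ht⟩, fun n _ => key n (by have := n.2; omega)⟩

/-! ### Scores -/

noncomputable def qf {𝒴 : Type*} {t : ℕ} (dist : 𝒴 → 𝒴 → ℝ) (ρ : ℝ) (Y : Fin t → 𝒴) : Fin t → ℝ :=
  fun i => (1 / (t : ℝ)) * ((Finset.univ.filter fun j => dist (Y i) (Y j) ≤ ρ).card : ℝ)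

noncomputable def Qf {𝒴 : Type*} {t : ℕ} (dist : 𝒴 → 𝒴 → ℝ) (ρ : ℝ) (Y : Fin t → 𝒴) : ℝ :=
  (1 / (t : ℝ)) * ∑ i, qf dist ρ Y i

noncomputable def goodSet {𝒴 : Type*} {t : ℕ} (dist : 𝒴 → 𝒴 → ℝ) (ρ : ℝ) (Y : Fin t → 𝒴) :
    Finset (Fin t) := Finset.univ.filter fun i => (0.6 : ℝ) < qf dist ρ Y i

noncomputable def outM {𝒴 : Type*} [MeasurableSpace 𝒴] {t : ℕ} (ℬ : 𝒴 → Measure 𝒴)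
    (Y : Fin t → 𝒴) (A : Finset (Fin t)) : Measure (Option 𝒴) :=
  if h : A.Nonempty then (ℬ (Y (A.min' h))).map Option.some else Measure.dirac none

noncomputable def stepM {𝒴 : Type*} [MeasurableSpace 𝒴] {t : ℕ} (ℬ : 𝒴 → Measure 𝒴)
    (dist : 𝒴 → 𝒴 → ℝ) (ρ τ : ℝ) (Y : Fin t → 𝒴) (x : ℝ) : Measure (Option 𝒴) :=
  if Qf dist ρ Y + x < τ then Measure.dirac none else outM ℬ Y (goodSet dist ρ Y)

lemma PPE_eq {𝒳 𝒴 : Type*} [MeasurableSpace 𝒴] (t : ℕ)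
    (𝒜 : List 𝒳 → Measure 𝒴) (ℬ : 𝒴 → Measure 𝒴)
    (dist : 𝒴 → 𝒴 → ℝ) (r ε δ z : ℝ) (D : List 𝒳) :
    PPE t 𝒜 ℬ dist r ε δ z D =
      (Measure.pi fun i : Fin t => 𝒜 ((D.drop (i.1 * (D.length / t))).take (D.length / t))).bind
        fun Y => (TLap (2 / t) ε δ).bind fun x => stepM ℬ dist (r / (2 * z))
          (0.8 + (2 / (t * ε)) * Real.log (1 + (Real.exp ε - 1) / (2 * δ))) Y x := rfl

lemma Qf_sens {𝒴 : Type*} {t : ℕ} (ht : 0 < t) (dist : 𝒴 → 𝒴 → ℝ) (ρ : ℝ) (Y Y' : Fin t → 𝒴)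
    (k : Fin t) (h : ∀ i, i ≠ k → Y i = Y' i) : Qf dist ρ Y ≤ Qf dist ρ Y' + 2 / t := by
  have ht' : (0 : ℝ) < t := by exact_mod_cast ht
  have e : ∀ W : Fin t → 𝒴, Qf dist ρ W = (1 / (t : ℝ)) * ((1 / (t : ℝ)) *
      ∑ i, ∑ j, if dist (W i) (W j) ≤ ρ then (1 : ℝ) else 0) := by
    intro W
    simp [Qf, qf, Finset.mul_sum]
  have key : (∑ i, ∑ j, if dist (Y i) (Y j) ≤ ρ then (1 : ℝ) else 0) ≤
      (∑ i, ∑ j, if dist (Y' i) (Y' j) ≤ ρ then (1 : ℝ) else 0) + 2 * t := by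
    have h2 : (∑ i : Fin t, ∑ j : Fin t, ((if i = k then (1 : ℝ) else 0) + if j = k then 1 else 0))
        = 2 * t := by
      simp [Finset.sum_add_distrib]; ring
    rw [← h2, ← Finset.sum_add_distrib]
    apply Finset.sum_le_sum
    intro i _
    rw [← Finset.sum_add_distrib]
    apply Finset.sum_le_sum
    intro j _
    by_cases hi : i = k
    · simp only [hi, if_true]; split_ifs <;> norm_num
    · by_cases hj : j = k
      · simp only [hj, if_true]; split_ifs <;> norm_num
      · simp [hi, hj, h i hi, h j hj]
  rw [e, e]
  calc _ ≤ (1 / (t : ℝ)) * ((1 / (t : ℝ)) * (_ + 2 * t)) := by gcongr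
    _ = _ := by field_simp

lemma goodSet_nonempty {𝒴 : Type*} {t : ℕ} (ht : 0 < t) (dist : 𝒴 → 𝒴 → ℝ) (ρ : ℝ)
    (Y : Fin t → 𝒴) (hQ : 0.8 ≤ Qf dist ρ Y) : (goodSet dist ρ Y).Nonempty := by
  have ht' : (0 : ℝ) < t := by exact_mod_cast ht
  by_contra hne
  rw [Finset.not_nonempty_iff_eq_empty, goodSet, Finset.filter_eq_empty_iff] at hne
  have : ∑ i, qf dist ρ Y i ≤ ∑ i : Fin t, (0.6 : ℝ) :=
    Finset.sum_le_sum fun i hi => not_lt.mp (hne hi)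
  have h2 : Qf dist ρ Y ≤ 0.6 := by
    unfold Qf
    calc _ ≤ (1 / (t : ℝ)) * ∑ i : Fin t, (0.6 : ℝ) := by gcongr
      _ = _ := by simp; field_simp
  norm_num at *
  linarith

lemma close_of_good {𝒴 : Type*} {t : ℕ} (ht : 5 < t) (dist : 𝒴 → 𝒴 → ℝ) (r z : ℝ) (hr : 0 < r)
    (hz : 1 ≤ z) (hsymm : ∀ F₁ F₂, dist F₁ F₂ = dist F₂ F₁)
    (htri : ∀ F₁ F₂ F₃, dist F₁ F₂ ≤ r → dist F₂ F₃ ≤ r →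
      dist F₁ F₃ ≤ z * (dist F₁ F₂ + dist F₂ F₃))
    (Y Y' : Fin t → 𝒴) (k : Fin t) (h : ∀ i, i ≠ k → Y i = Y' i) (i i' : Fin t)
    (hi : i ∈ goodSet dist (r / (2 * z)) Y) (hi' : i' ∈ goodSet dist (r / (2 * z)) Y') :
    dist (Y i) (Y' i') ≤ r := by
  have ht' : (5 : ℝ) < t := by exact_mod_cast ht
  have hle : r / (2 * z) ≤ r := div_le_self hr.le (by linarith)
  replace hi := (Finset.mem_filter.mp hi).2
  replace hi' := (Finset.mem_filter.mp hi').2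
  unfold qf at hi hi'
  set U := Finset.univ.filter fun j => dist (Y i) (Y j) ≤ r / (2 * z) with hU
  set V := Finset.univ.filter fun j => dist (Y' i') (Y' j) ≤ r / (2 * z) with hV
  have hUc : 0.6 * (t : ℝ) < U.card := by
    rw [one_div, inv_mul_eq_div, lt_div_iff₀ (by linarith)] at hi; exact hi
  have hVc : 0.6 * (t : ℝ) < V.card := by
    rw [one_div, inv_mul_eq_div, lt_div_iff₀ (by linarith)] at hi'; exact hi'
  have hcard : (U ∪ V).card + (U ∩ V).card = U.card + V.card := Finset.card_union_add_card_inter U V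
  have hun : (U ∪ V).card ≤ t := by simpa using Finset.card_le_univ (U ∪ V)
  have h1 : 1 < (U ∩ V).card := by
    have a1 : ((U ∪ V).card : ℝ) + (U ∩ V).card = U.card + V.card := by exact_mod_cast hcard
    have a2 : ((U ∪ V).card : ℝ) ≤ t := by exact_mod_cast hun
    have : (1 : ℝ) < (U ∩ V).card := by linarith
    exact_mod_cast this
  obtain ⟨l, hl, hlk⟩ := Finset.exists_mem_ne h1 k
  rw [Finset.mem_inter, hU, hV, Finset.mem_filter, Finset.mem_filter] at hl
  obtain ⟨⟨-, hl1⟩, -, hl2⟩ := hl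
  rw [hsymm, ← h l hlk] at hl2
  refine (htri _ _ _ (hl1.trans hle) (hl2.trans hle)).trans ?_
  calc z * (dist (Y i) (Y l) + dist (Y l) (Y' i')) ≤ z * (r / (2 * z) + r / (2 * z)) := by gcongr
    _ = r := by field_simp; ring

lemma measurable_some' {𝒴 : Type*} [MeasurableSpace 𝒴] :
    Measurable (Option.some : 𝒴 → Option 𝒴) := by
  rw [measurable_comap_iff]
  exact measurable_inl

lemma outM_prob {𝒴 : Type*} [MeasurableSpace 𝒴] {t : ℕ} (ℬ : 𝒴 → Measure 𝒴)
    (hℬprob : ∀ F, IsProbabilityMeasure (ℬ F)) (Y : Fin t → 𝒴) (A : Finset (Fin t)) :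
    IsProbabilityMeasure (outM ℬ Y A) := by
  unfold outM
  split_ifs with h
  · exact Measure.isProbabilityMeasure_map measurable_some'.aemeasurable
  · infer_instance

section meas
variable {𝒴 : Type*} [MeasurableSpace 𝒴] {t : ℕ} (ℬ : 𝒴 → Measure 𝒴)
    (dist : 𝒴 → 𝒴 → ℝ) (ρ τ : ℝ)

lemma qf_meas (hdistmeas : Measurable (Function.uncurry dist)) (i : Fin t) :
    Measurable fun Y : Fin t → 𝒴 => qf dist ρ Y i := by
  have e : (fun Y : Fin t → 𝒴 => qf dist ρ Y i) = fun Y => (1 / (t : ℝ)) *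
      ∑ j, if dist (Y i) (Y j) ≤ ρ then (1 : ℝ) else 0 := by
    ext Y; simp [qf]
  rw [e]
  refine Measurable.const_mul (Finset.measurable_sum _ fun j _ => ?_) _
  refine Measurable.ite ?_ measurable_const measurable_const
  have : Measurable fun Y : Fin t → 𝒴 => dist (Y i) (Y j) :=
    hdistmeas.comp (f := fun Y : Fin t → 𝒴 => (Y i, Y j))
      ((measurable_pi_apply i).prodMk (measurable_pi_apply j))
  exact measurableSet_le this measurable_const

lemma Qf_meas (hdistmeas : Measurable (Function.uncurry dist)) :
    Measurable fun Y : Fin t → 𝒴 => Qf dist ρ Y :=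
  Measurable.const_mul (Finset.measurable_sum _ fun i _ => qf_meas dist ρ hdistmeas i) _

lemma outM_meas (hdistmeas : Measurable (Function.uncurry dist))
    (hℬmeas : ∀ S : Set 𝒴, MeasurableSet S → Measurable fun F => ℬ F S) :
    Measurable fun Y : Fin t → 𝒴 => outM ℬ Y (goodSet dist ρ Y) := by
  apply Measure.measurable_of_measurable_coe
  intro S hS
  have e : (fun Y : Fin t → 𝒴 => outM ℬ Y (goodSet dist ρ Y) S) = fun Y =>
      ∑ A : Finset (Fin t), if goodSet dist ρ Y = A then outM ℬ Y A S else 0 := by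
    ext Y; simp
  rw [e]
  refine Finset.measurable_sum _ fun A _ => ?_
  refine Measurable.ite ?_ ?_ measurable_const
  · have : {Y : Fin t → 𝒴 | goodSet dist ρ Y = A} =
        ⋂ i, {Y | (0.6 : ℝ) < qf dist ρ Y i ↔ i ∈ A} := by
      ext Y; simp [goodSet, Finset.ext_iff]
    rw [this]
    refine MeasurableSet.iInter fun i => ?_
    have hm : MeasurableSet {Y : Fin t → 𝒴 | (0.6 : ℝ) < qf dist ρ Y i} :=
      measurableSet_lt measurable_const (qf_meas dist ρ hdistmeas i)
    by_cases hi : i ∈ A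
    · simpa [hi] using hm
    · simp only [hi, iff_false]; exact hm.compl
  · unfold outM
    split_ifs with h
    · have : (fun Y : Fin t → 𝒴 => (ℬ (Y (A.min' h))).map Option.some S) =
          fun Y => ℬ (Y (A.min' h)) (Option.some ⁻¹' S) := by
        ext Y; rw [Measure.map_apply measurable_some' hS]
      rw [this]
      exact (hℬmeas _ (measurable_some' hS)).comp (measurable_pi_apply _)
    · exact measurable_const

lemma stepM_meas (hdistmeas : Measurable (Function.uncurry dist))
    (hℬmeas : ∀ S : Set 𝒴, MeasurableSet S → Measurable fun F => ℬ F S) :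
    Measurable fun p : (Fin t → 𝒴) × ℝ => stepM ℬ dist ρ τ p.1 p.2 := by
  unfold stepM
  refine Measurable.ite ?_ measurable_const ((outM_meas ℬ dist ρ hdistmeas hℬmeas).comp measurable_fst)
  exact measurableSet_lt (((Qf_meas dist ρ hdistmeas).comp measurable_fst).add measurable_snd)
    measurable_const

lemma inner_meas (T : Measure ℝ) [SFinite T] (hdistmeas : Measurable (Function.uncurry dist))
    (hℬmeas : ∀ S : Set 𝒴, MeasurableSet S → Measurable fun F => ℬ F S) :
    Measurable fun Y : Fin t → 𝒴 => T.bind fun x => stepM ℬ dist ρ τ Y x := by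
  have hm := stepM_meas (t := t) ℬ dist ρ τ hdistmeas hℬmeas
  apply Measure.measurable_of_measurable_coe
  intro S hS
  have e : (fun Y : Fin t → 𝒴 => (T.bind fun x => stepM ℬ dist ρ τ Y x) S) =
      fun Y => ∫⁻ x, stepM ℬ dist ρ τ Y x S ∂T := by
    ext Y
    rw [Measure.bind_apply (f := fun x => stepM ℬ dist ρ τ Y x) hS
      (hm.comp (f := Prod.mk Y) measurable_prodMk_left).aemeasurable]
  rw [e]
  exact Measurable.lintegral_prod_right' (f := fun p : (Fin t → 𝒴) × ℝ => stepM ℬ dist ρ τ p.1 p.2 S)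
    ((Measure.measurable_coe hS).comp hm)

lemma inner_apply (T : Measure ℝ) (hdistmeas : Measurable (Function.uncurry dist))
    (hℬmeas : ∀ S : Set 𝒴, MeasurableSet S → Measurable fun F => ℬ F S)
    (Y : Fin t → 𝒴) (S : Set (Option 𝒴)) (hS : MeasurableSet S) :
    (T.bind fun x => stepM ℬ dist ρ τ Y x) S =
      T (Set.Iio (τ - Qf dist ρ Y)) * (Measure.dirac none : Measure (Option 𝒴)) S +
      T (Set.Ici (τ - Qf dist ρ Y)) * outM ℬ Y (goodSet dist ρ Y) S := by
  have hm := stepM_meas (t := t) ℬ dist ρ τ hdistmeas hℬmeas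
  rw [Measure.bind_apply (f := fun x => stepM ℬ dist ρ τ Y x) hS
      (hm.comp (f := Prod.mk Y) measurable_prodMk_left).aemeasurable,
    ← lintegral_add_compl _ (measurableSet_Iio (a := τ - Qf dist ρ Y)), Set.compl_Iio,
    setLIntegral_congr_fun (g := fun _ => (Measure.dirac none : Measure (Option 𝒴)) S)
      measurableSet_Iio,
    setLIntegral_congr_fun (g := fun _ => outM ℬ Y (goodSet dist ρ Y) S) measurableSet_Ici]
  · simp [mul_comm]
  · intro x hx
    have hx : τ - Qf dist ρ Y ≤ x := hx
    simp only [stepM]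
    rw [if_neg (by linarith)]
  · intro x hx
    have hx : x < τ - Qf dist ρ Y := hx
    simp only [stepM]
    rw [if_pos (by linarith)]
end meas

lemma arith {x x' p p' o o' n E d : ENNReal} (hE : 1 ≤ E)
    (hx : x ≤ E * x' + d) (hn : n ≤ 1) (hpo : p * o ≤ E * E * (p' * o') + 3 * (E * d)) :
    x * n + p * o ≤ E * E * (x' * n + p' * o') + 4 * (E * d) := by
  have h1 : x * n ≤ E * E * (x' * n) + E * d := by
    calc x * n ≤ (E * x' + d) * n := by gcongr
      _ = 1 * E * (x' * n) + 1 * d * n := by ring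
      _ ≤ E * E * (x' * n) + E * d * 1 := by gcongr
      _ = _ := by ring
  calc _ ≤ _ := add_le_add h1 hpo
    _ = _ := by ring

lemma arith2 {p p' o o' E d : ENNReal} (hE : 1 ≤ E)
    (hp : p ≤ E * p' + d) (ho : o ≤ E * o' + d) (hp1 : p ≤ 1) (ho' : o' ≤ 1) :
    p * o ≤ E * E * (p' * o') + 3 * (E * d) := by
  calc p * o ≤ p * (E * o' + d) := by gcongr
    _ = p * (E * o') + p * d := by ring
    _ ≤ (E * p' + d) * (E * o') + 1 * d := by gcongr
    _ = E * E * (p' * o') + (E * d * o' + 1 * d) := by ring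
    _ ≤ E * E * (p' * o') + (E * d * 1 + E * d) := by gcongr
    _ = E * E * (p' * o') + 2 * (E * d) := by ring
    _ ≤ _ := by gcongr; norm_num

/-- **Privacy of the Private Populous Estimator.** If `(𝒴, dist)` is a semimetric space
satisfying the `z`-approximate `r`-restricted triangle inequality, `ℬ` is an
`(r, ε, δ)`-masking mechanism for `(𝒴, dist)`, and `t > 5`, then PPE is
`(2ε, 4 e^ε δ)`-differentially private: for all neighboring datasets `D, D'` and every
measurable set `S` of outputs, `Pr[PPE(D) ∈ S] ≤ e^{2ε} Pr[PPE(D') ∈ S] + 4 e^ε δ`. -/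
theorem ppe_privacy {𝒳 𝒴 : Type*} [MeasurableSpace 𝒴]
    (dist : 𝒴 → 𝒴 → ℝ) (r ε δ z : ℝ) (t : ℕ)
    (𝒜 : List 𝒳 → Measure 𝒴) (ℬ : 𝒴 → Measure 𝒴)
    (hr : 0 < r) (hε : 0 < ε) (hδ : 0 < δ) (hz : 1 ≤ z) (ht : 5 < t)
    -- `(𝒴, dist)` is a semimetric space:
    (hrefl : ∀ F, dist F F = 0)
    (hnonneg : ∀ F₁ F₂, 0 ≤ dist F₁ F₂)
    (hsymm : ∀ F₁ F₂, dist F₁ F₂ = dist F₂ F₁)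
    (htri : ∀ F₁ F₂ F₃, dist F₁ F₂ ≤ r → dist F₂ F₃ ≤ r →
      dist F₁ F₃ ≤ z * (dist F₁ F₂ + dist F₂ F₃))
    (hdistmeas : Measurable (Function.uncurry dist))
    -- `𝒜` and `ℬ` are randomized algorithms (Markov kernels):
    (h𝒜 : ∀ L, IsProbabilityMeasure (𝒜 L))
    (hℬprob : ∀ F, IsProbabilityMeasure (ℬ F))
    (hℬmeas : ∀ S : Set 𝒴, MeasurableSet S → Measurable fun F => ℬ F S)
    -- `ℬ` is an `(r, ε, δ)`-masking mechanism for `(𝒴, dist)`: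
    (hmask : ∀ F F', dist F F' ≤ r → Indist ε δ (ℬ F) (ℬ F'))
    (D D' : List 𝒳) (hnb : Neighboring D D')
    (S : Set (Option 𝒴)) (hS : MeasurableSet S) :
    PPE t 𝒜 ℬ dist r ε δ z D S ≤
      ENNReal.ofReal (Real.exp (2 * ε)) * PPE t 𝒜 ℬ dist r ε δ z D' S +
        ENNReal.ofReal (4 * Real.exp ε * δ) := by
  have ht0 : 0 < t := by omega
  have htR : (0 : ℝ) < t := by exact_mod_cast ht0
  have hΔ : (0 : ℝ) < 2 / t := by positivity
  have := TLap_prob hΔ hε hδ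
  obtain ⟨k, hk⟩ := chunk_eq D D' hnb t ht0 (D.length / t)
  rw [PPE_eq, PPE_eq, ← hnb.1]
  set τ := 0.8 + (2 / (t * ε)) * Real.log (1 + (Real.exp ε - 1) / (2 * δ)) with hτ
  have hτB : τ = 0.8 + Bd (2 / t) ε δ := by rw [hτ, Bd, div_div]
  set T := TLap (2 / t) ε δ with hT
  have hm := inner_meas (t := t) ℬ dist (r / (2 * z)) τ T hdistmeas hℬmeas
  rw [Measure.bind_apply hS hm.aemeasurable, Measure.bind_apply hS hm.aemeasurable]
  have hc1 : ENNReal.ofReal (Real.exp (2 * ε)) =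
      ENNReal.ofReal (Real.exp ε) * ENNReal.ofReal (Real.exp ε) := by
    rw [← ENNReal.ofReal_mul (Real.exp_pos _).le, ← Real.exp_add]; ring_nf
  have hc2 : ENNReal.ofReal (4 * Real.exp ε * δ) =
      4 * (ENNReal.ofReal (Real.exp ε) * ENNReal.ofReal δ) := by
    rw [mul_assoc, ENNReal.ofReal_mul (by norm_num), ENNReal.ofReal_mul (Real.exp_pos _).le]
    norm_num
  have hE : 1 ≤ ENNReal.ofReal (Real.exp ε) :=
    ENNReal.one_le_ofReal.mpr (Real.one_le_exp hε.le)
  rw [hc1, hc2]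
  refine couple_le _ _ k (fun i hi => by rw [hk i hi]) _ ((Measure.measurable_coe hS).comp hm) _ _ ?_
  intro Y y
  have hY : ∀ i, i ≠ k → Y i = Function.update Y k y i := fun i hi => by simp [hi]
  generalize Function.update Y k y = Y' at hY
  have hq1 := Qf_sens ht0 dist (r / (2 * z)) Y Y' k hY
  have hq2 := Qf_sens ht0 dist (r / (2 * z)) Y' Y k (fun i hi => (hY i hi).symm)
  have hs : |Qf dist (r / (2 * z)) Y' - Qf dist (r / (2 * z)) Y| ≤ 2 / t := by
    rw [abs_le]; constructor <;> linarith
  simp only [Function.comp]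
  rw [inner_apply ℬ dist _ τ T hdistmeas hℬmeas Y S hS,
    inner_apply ℬ dist _ τ T hdistmeas hℬmeas Y' S hS]
  have := outM_prob ℬ hℬprob Y (goodSet dist (r / (2 * z)) Y)
  have := outM_prob ℬ hℬprob Y' (goodSet dist (r / (2 * z)) Y')
  have hx := TLap_shift hΔ hε hδ hs (Set.Iio (τ - Qf dist (r / (2 * z)) Y)) measurableSet_Iio
  have hp := TLap_shift hΔ hε hδ hs (Set.Ici (τ - Qf dist (r / (2 * z)) Y)) measurableSet_Ici
  rw [Set.preimage_add_const_Iio, sub_sub, add_sub_cancel] at hx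
  rw [Set.preimage_add_const_Ici, sub_sub, add_sub_cancel] at hp
  apply arith hE hx prob_le_one
  by_cases h1 : Qf dist (r / (2 * z)) Y < 0.8
  · rw [hT, TLap_tail (c := τ - Qf dist (r / (2 * z)) Y) (by rw [hτB]; linarith)]
    simp
  by_cases h2 : Qf dist (r / (2 * z)) Y' < 0.8
  · rw [TLap_tail (c := τ - Qf dist (r / (2 * z)) Y') (by rw [hτB]; linarith), mul_zero,
      zero_add] at hp
    calc _ ≤ ENNReal.ofReal δ * 1 := mul_le_mul' hp prob_le_one
      _ = 1 * (1 * ENNReal.ofReal δ) := by ring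
      _ ≤ 3 * (ENNReal.ofReal (Real.exp ε) * ENNReal.ofReal δ) := by
        gcongr; norm_num
      _ ≤ _ := le_add_self
  · have g1 := goodSet_nonempty ht0 dist _ Y (not_lt.mp h1)
    have g2 := goodSet_nonempty ht0 dist _ Y' (not_lt.mp h2)
    refine arith2 hE hp ?_ prob_le_one prob_le_one
    rw [outM, outM, dif_pos g1, dif_pos g2, Measure.map_apply measurable_some' hS,
      Measure.map_apply measurable_some' hS]
    refine (hmask _ _ ?_ _ (measurable_some' hS)).1
    exact close_of_good ht dist r z hr hz hsymm htri Y Y' k hY _ _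
      (Finset.min'_mem _ _) (Finset.min'_mem _ _)
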